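/- arXiv:1009.3949 — 3 statements merged into one kernel-verified Lean document; each statement's English description precedes it below -/
import Mathlib

section
/- Let r > 0 and let h : ℝ → ℂ be a C^∞ function. Then there exists a function h_r ∈ C₂ such that h_r(x) = h(x) for all x with |x| ≤ r; moreover one may take h_r = ν̂_r where ν_r is the measure with density given by the inverse Fourier transform of ψ_r·h for a suitable smooth compactly supported cutoff ψ_r equal to 1 on [−r,r]. -/
open MeasureTheory

theorem stmt12 (r : ℝ) (hr : 0 < r) (h : ℝ → ℂ) (hh : ContDiff ℝ (⊤ : ℕ∞) h) :
    ∃ (w : ℝ → ℂ) (ψr : ℝ → ℝ),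
      Continuous w ∧ Integrable w ∧ Integrable (fun ξ : ℝ => ξ ^ 2 * ‖w ξ‖) ∧
      ContDiff ℝ (⊤ : ℕ∞) ψr ∧ HasCompactSupport ψr ∧ (∀ x : ℝ, |x| ≤ r → ψr x = 1) ∧
      (∀ ξ : ℝ, w ξ = (1 / (2 * Real.pi) : ℂ) *
        ∫ x : ℝ, Complex.exp (-(Complex.I * (ξ : ℂ) * (x : ℂ))) * ((ψr x : ℂ) * h x)) ∧
      (∀ x : ℝ, |x| ≤ r →
        h x = ∫ ξ : ℝ, Complex.exp (Complex.I * (x : ℂ) * (ξ : ℂ)) * w ξ) := by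
  have hpi : (2 * Real.pi : ℝ) ≠ 0 := by positivity
  have hpiC : (2 * Real.pi : ℂ) ≠ 0 := by exact_mod_cast hpi
  let b : ContDiffBump (0 : ℝ) := ⟨r, r + 1, hr, by linarith⟩
  have hb1 : ∀ x : ℝ, |x| ≤ r → b x = 1 := fun x hx =>
    b.one_of_mem_closedBall (by simpa [b] using hx)
  have hbs : ContDiff ℝ (⊤ : ℕ∞) (fun x : ℝ => b x) := b.contDiff
  have hbc : HasCompactSupport (fun x : ℝ => b x) := b.hasCompactSupport
  have hfs : ContDiff ℝ (⊤ : ℕ∞) (fun x : ℝ => ((b x : ℝ) : ℂ) * h x) :=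
    (Complex.ofRealCLM.contDiff.comp hbs).mul hh
  have hfc : HasCompactSupport (fun x : ℝ => ((b x : ℝ) : ℂ) * h x) :=
    HasCompactSupport.mul_right (hbc.comp_left (g := fun y : ℝ => (y : ℂ)) (by simp))
  let f : SchwartzMap ℝ ℂ := hfc.toSchwartzMap hfs
  have hf : ∀ x, f x = ((b x : ℝ) : ℂ) * h x := fun x => rfl
  let F : SchwartzMap ℝ ℂ := FourierTransform.fourier f
  have hF : ∀ y : ℝ, F y = ∫ x : ℝ,
      Complex.exp (((-2 * Real.pi * inner ℝ x y : ℝ) : ℂ) * Complex.I) • f x := by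
    intro y
    simp only [F]
    rw [SchwartzMap.fourier_coe, Real.fourier_eq']
  have hinv : ∀ x : ℝ, f x = ∫ y : ℝ,
      Complex.exp (((2 * Real.pi * inner ℝ y x : ℝ) : ℂ) * Complex.I) • F y := by
    intro x
    rw [← Real.fourierInv_eq', ← SchwartzMap.fourierInv_coe]
    simp [F]
  refine ⟨fun ξ => (1 / (2 * Real.pi) : ℂ) * F (ξ / (2 * Real.pi)), fun x => b x,
    ?_, ?_, ?_, hbs, hbc, hb1, ?_, ?_⟩
  · exact continuous_const.mul (F.continuous.comp (continuous_id.div_const _))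
  · exact (F.integrable.comp_div hpi).const_mul _
  · have := ((F.integrable_pow_mul volume 2).comp_div hpi).const_mul (2 * Real.pi)
    refine this.congr (Filter.Eventually.of_forall fun ξ => ?_)
    simp only [norm_mul, norm_div, norm_one, Complex.norm_real, Complex.norm_ofNat, Real.norm_eq_abs,
      sq_abs, abs_of_pos Real.pi_pos]
    rw [div_pow, abs_of_pos (by positivity : (0 : ℝ) < 2)]
    field_simp
    rw [sq_abs]
  · intro ξ
    beta_reduce
    rw [hF]
    congr 1
    refine integral_congr_ae (Filter.Eventually.of_forall fun x => ?_)
    simp only [hf, smul_eq_mul]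
    congr 2
    simp only [RCLike.inner_apply, conj_trivial]
    push_cast
    field_simp
  · intro x hx
    have h1 : h x = f x := by rw [hf, hb1 x hx]; simp
    rw [h1, hinv]
    have h2 := Measure.integral_comp_div (fun y : ℝ =>
      Complex.exp (((2 * Real.pi * inner ℝ y x : ℝ) : ℂ) * Complex.I) • F y) (2 * Real.pi)
    have h3 : (fun ξ : ℝ => Complex.exp (Complex.I * (x : ℂ) * (ξ : ℂ)) *
        ((1 / (2 * Real.pi) : ℂ) * F (ξ / (2 * Real.pi)))) = fun ξ : ℝ =>
        (1 / (2 * Real.pi) : ℂ) *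
        (Complex.exp (((2 * Real.pi * inner ℝ (ξ / (2 * Real.pi)) x : ℝ) : ℂ) * Complex.I)
          • F (ξ / (2 * Real.pi))) := by
      funext ξ
      rw [smul_eq_mul, mul_left_comm]
      congr 3
      simp only [RCLike.inner_apply, conj_trivial]
      push_cast
      field_simp
    rw [h3, integral_const_mul, h2, abs_of_pos (by positivity), Complex.real_smul, ← mul_assoc]
    push_cast
    rw [one_div, inv_mul_cancel₀ hpiC, one_mul]
end

section
/- Let ν be a complex Borel measure on ℝ with ∫_ℝ ξ² |ν|(dξ) < ∞ and set h = ν̂, h(x) = ∫_ℝ e^{ixξ} ν(dξ). Let K ⊂ ℝ be a compact interval. Then there exists a sequence of complex Borel measures ν_n on ℝ with ∫_ℝ ξ² |ν_n|(dξ) < ∞ such that, setting h_n = ν̂_n: (1) each h_n agrees on K with a polynomial function; (2) ∫_ℝ ξ² |ν_n|(dξ) → ∫_ℝ ξ² |ν|(dξ) as n → ∞; (3) for every probability measure μ on ℝ supported in K, ∫ h_n dμ → ∫ h dμ as n → ∞. -/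
open MeasureTheory

lemma norm_exp_aux (x ξ : ℝ) : ‖Complex.exp (Complex.I * (x:ℂ) * (ξ:ℂ))‖ = 1 := by
  rw [show Complex.I * (x:ℂ) * (ξ:ℂ) = ((x*ξ : ℝ):ℂ) * Complex.I by push_cast; ring]
  exact Complex.norm_exp_ofReal_mul_I _

lemma int_exp_aux {μ : Measure ℝ} {u : ℝ → ℂ} (hu : Integrable u μ) (x : ℝ) :
    Integrable (fun ξ : ℝ => Complex.exp (Complex.I * (x:ℂ) * (ξ:ℂ)) * u ξ) μ := by
  refine hu.bdd_mul (c := 1) (Continuous.aestronglyMeasurable (by fun_prop)) ?_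
  exact Filter.Eventually.of_forall fun ξ => (norm_exp_aux x ξ).le

lemma combine (ρ : Measure ℝ) [IsFiniteMeasure ρ] (u g : ℝ → ℂ) (hu : Integrable u ρ)
    (hu2 : Integrable (fun ξ : ℝ => ξ^2 * ‖u ξ‖) ρ) (hg : Integrable g)
    (hg2 : Integrable (fun ξ : ℝ => ξ^2 * ‖g ξ‖)) :
    ∃ (ρ' : Measure ℝ) (w' : ℝ → ℂ), IsFiniteMeasure ρ' ∧ AEStronglyMeasurable w' ρ' ∧
      (∀ᵐ ξ ∂ρ', ‖w' ξ‖ = 1) ∧ Integrable (fun ξ : ℝ => ξ^2) ρ' ∧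
      (∀ x : ℝ, ∫ ξ, Complex.exp (Complex.I * (x:ℂ) * (ξ:ℂ)) * w' ξ ∂ρ' =
        (∫ ξ, Complex.exp (Complex.I * (x:ℂ) * (ξ:ℂ)) * u ξ ∂ρ) +
          ∫ ξ : ℝ, Complex.exp (Complex.I * (x:ℂ) * (ξ:ℂ)) * g ξ) ∧
      |(∫ ξ, ξ^2 ∂ρ') - ∫ ξ, ξ^2 * ‖u ξ‖ ∂ρ| ≤ ∫ ξ, ξ^2 * ‖g ξ‖ := by
  let σ : Measure ℝ := ρ + volume
  have h1 : ρ ≪ σ := Measure.absolutelyContinuous_of_le (Measure.le_add_right le_rfl)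
  have h2 : (volume : Measure ℝ) ≪ σ := Measure.absolutelyContinuous_of_le (Measure.le_add_left le_rfl)
  let α : ℝ → ℝ := fun x => (ρ.rnDeriv σ x).toReal
  let β : ℝ → ℝ := fun x => ((volume : Measure ℝ).rnDeriv σ x).toReal
  have hα0 : ∀ x, 0 ≤ α x := fun x => ENNReal.toReal_nonneg
  have hβ0 : ∀ x, 0 ≤ β x := fun x => ENNReal.toReal_nonneg
  let f : ℝ → ℂ := fun x => α x • u x + β x • g x
  have hf : Integrable f σ :=
    ((integrable_rnDeriv_smul_iff h1).2 hu).add ((integrable_rnDeriv_smul_iff h2).2 hg)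
  have hu2' : Integrable (fun ξ : ℝ => α ξ * (ξ^2 * ‖u ξ‖)) σ := (integrable_rnDeriv_smul_iff h1).2 hu2
  have hg2' : Integrable (fun ξ : ℝ => β ξ * (ξ^2 * ‖g ξ‖)) σ := (integrable_rnDeriv_smul_iff h2).2 hg2
  have hf2 : Integrable (fun ξ : ℝ => ‖f ξ‖ * ξ^2) σ := by
    refine (hu2'.add hg2').mono' (hf.aestronglyMeasurable.norm.mul (by fun_prop)) ?_
    refine Filter.Eventually.of_forall fun ξ => ?_
    rw [Real.norm_of_nonneg (by positivity)]
    have : ‖f ξ‖ ≤ α ξ * ‖u ξ‖ + β ξ * ‖g ξ‖ := by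
      refine (norm_add_le _ _).trans ?_
      rw [norm_smul, norm_smul, Real.norm_of_nonneg (hα0 ξ), Real.norm_of_nonneg (hβ0 ξ)]
    calc _ ≤ (α ξ * ‖u ξ‖ + β ξ * ‖g ξ‖) * ξ^2 := by gcongr
      _ = _ := by simp only [Pi.add_apply]; ring
  have hm : AEMeasurable (fun x => ‖f x‖₊) σ := hf.aestronglyMeasurable.aemeasurable.nnnorm
  refine ⟨σ.withDensity (fun x => (‖f x‖₊ : ENNReal)), fun x => f x / (‖f x‖ : ℂ), ?_, ?_, ?_, ?_, ?_, ?_⟩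
  · exact isFiniteMeasure_withDensity (ne_of_lt hf.2)
  · refine AEStronglyMeasurable.mono_ac (withDensity_absolutelyContinuous _ _) ?_
    exact (hf.aestronglyMeasurable.aemeasurable.div
      (Complex.measurable_ofReal.comp_aemeasurable hf.aestronglyMeasurable.aemeasurable.norm)).aestronglyMeasurable
  · rw [ae_withDensity_iff' hm.coe_nnreal_ennreal]
    refine Filter.Eventually.of_forall fun x hx => ?_
    have : ‖f x‖ ≠ 0 := by simpa using hx
    rw [norm_div, Complex.norm_real, norm_norm, div_self this]
  · rw [integrable_withDensity_iff_integrable_smul₀ hm]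
    exact hf2
  · intro x
    rw [integral_withDensity_eq_integral_smul₀ hm]
    have e1 : ∀ ξ : ℝ, ‖f ξ‖₊ • (Complex.exp (Complex.I * (x:ℂ) * (ξ:ℂ)) * (f ξ / (‖f ξ‖:ℂ))) =
        α ξ • (Complex.exp (Complex.I * (x:ℂ) * (ξ:ℂ)) * u ξ) +
        β ξ • (Complex.exp (Complex.I * (x:ℂ) * (ξ:ℂ)) * g ξ) := by
      intro ξ
      have : ‖f ξ‖₊ • (Complex.exp (Complex.I * (x:ℂ) * (ξ:ℂ)) * (f ξ / (‖f ξ‖:ℂ))) =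
          Complex.exp (Complex.I * (x:ℂ) * (ξ:ℂ)) * f ξ := by
        rw [NNReal.smul_def, coe_nnnorm, Complex.real_smul]
        by_cases h : f ξ = 0
        · simp [h]
        · have : (‖f ξ‖ : ℂ) ≠ 0 := by simpa using h
          field_simp
      rw [this]
      simp only [f, Complex.real_smul]
      ring
    simp_rw [e1]
    rw [integral_add ((integrable_rnDeriv_smul_iff h1).2 (int_exp_aux hu x))
      ((integrable_rnDeriv_smul_iff h2).2 (int_exp_aux hg x)), integral_rnDeriv_smul h1, integral_rnDeriv_smul h2]
  · rw [integral_withDensity_eq_integral_smul₀ hm]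
    have e1 : ∫ ξ, ξ^2 * ‖u ξ‖ ∂ρ = ∫ ξ, α ξ * (ξ^2 * ‖u ξ‖) ∂σ := (integral_rnDeriv_smul h1).symm
    have e2 : ∫ ξ, ξ^2 * ‖g ξ‖ = ∫ ξ, β ξ * (ξ^2 * ‖g ξ‖) ∂σ := (integral_rnDeriv_smul h2).symm
    rw [e1, e2, ← integral_sub (by exact hf2) hu2', ← Real.norm_eq_abs]
    refine norm_integral_le_of_norm_le hg2' (Filter.Eventually.of_forall fun ξ => ?_)
    rw [NNReal.smul_def, coe_nnnorm, smul_eq_mul, Real.norm_eq_abs]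
    have k1 : |‖f ξ‖ - ‖α ξ • u ξ‖| ≤ ‖β ξ • g ξ‖ := by
      refine (abs_norm_sub_norm_le _ _).trans ?_
      simp [f]
    rw [norm_smul, norm_smul, Real.norm_of_nonneg (hα0 ξ), Real.norm_of_nonneg (hβ0 ξ)] at k1
    rw [show ‖f ξ‖ * ξ^2 - α ξ * (ξ^2 * ‖u ξ‖) = (‖f ξ‖ - α ξ * ‖u ξ‖) * ξ^2 by ring, abs_mul, abs_of_nonneg (sq_nonneg ξ)]
    calc _ ≤ (β ξ * ‖g ξ‖) * ξ^2 := by gcongr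
      _ = _ := by ring

lemma iter_mul_aux (f : ℝ → ℂ) (hf : ContDiff ℝ (⊤ : ℕ∞) f) (m : ℕ) :
    iteratedDeriv (m+1) (fun x : ℝ => (x:ℂ) * f x) =
      fun x : ℝ => (x:ℂ) * iteratedDeriv (m+1) f x + ((m:ℂ)+1) * iteratedDeriv m f x := by
  have hd : ∀ m : ℕ, ∀ x, HasDerivAt (iteratedDeriv m f) (iteratedDeriv (m+1) f x) x := by
    intro m x
    rw [iteratedDeriv_succ]
    exact ((hf.differentiable_iteratedDeriv m (by exact_mod_cast ENat.natCast_lt_top m)) x).hasDerivAt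
  have hx : ∀ x : ℝ, HasDerivAt (fun x : ℝ => (x:ℂ)) 1 x := fun x => Complex.ofRealCLM.hasDerivAt
  induction m with
  | zero =>
    funext x
    rw [zero_add, iteratedDeriv_one]
    have h0 := hd 0 x
    rw [iteratedDeriv_zero] at h0
    refine Eq.trans ((hx x).mul h0).deriv ?_
    simp
    ring
  | succ m ih =>
    rw [iteratedDeriv_succ, ih]
    funext x
    have := ((hx x).mul (hd (m+1) x)).add ((hd m x).const_mul ((m:ℂ)+1))
    refine Eq.trans this.deriv ?_
    push_cast
    ring

lemma iter_zero_aux (f : ℝ → ℂ) (B : ℝ) (hB : ∀ x, B ≤ |x| → f x = 0) (m : ℕ) (x : ℝ) (hx : B < |x|) :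
    iteratedDeriv m f x = 0 := by
  have : f =ᶠ[nhds x] fun _ => 0 := by
    filter_upwards [(isOpen_lt continuous_const continuous_abs).mem_nhds hx] with y hy
    exact hB y (le_of_lt hy)
  rw [this.iteratedDeriv_eq]
  simp

lemma iter_bound_aux (χ : ℝ → ℂ) (hχ : ContDiff ℝ (⊤ : ℕ∞) χ) (B : ℝ) (hB0 : 0 ≤ B)
    (hB : ∀ x, B ≤ |x| → χ x = 0) :
    ∃ A : ℝ, 0 ≤ A ∧ ∀ k : ℕ, ∀ m ≤ 4, ∀ x,
      ‖iteratedDeriv m (fun x : ℝ => (x:ℂ)^k * χ x) x‖ ≤ A * (B+4)^k := by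
  have hbd : ∀ m : ℕ, ∃ A : ℝ, 0 ≤ A ∧ ∀ x, ‖iteratedDeriv m χ x‖ ≤ A := by
    intro m
    have hc : Continuous (iteratedDeriv m χ) := hχ.continuous_iteratedDeriv m (by exact_mod_cast le_top)
    obtain ⟨A, hA⟩ := (isCompact_Icc (a := -B) (b := B)).exists_bound_of_continuousOn hc.continuousOn
    refine ⟨max A 0, le_max_right _ _, fun x => ?_⟩
    by_cases h : |x| ≤ B
    · exact (hA x (abs_le.mp h)).trans (le_max_left _ _)
    · rw [iter_zero_aux χ B hB m x (not_le.mp h)]; simp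
  choose A hA0 hA using hbd
  refine ⟨∑ m ∈ Finset.range 5, A m, Finset.sum_nonneg fun i _ => hA0 i, fun k => ?_⟩
  set S := ∑ m ∈ Finset.range 5, A m
  have hS : 0 ≤ S := Finset.sum_nonneg fun i _ => hA0 i
  induction k with
  | zero =>
    intro m hm x
    simp only [pow_zero, one_mul, mul_one]
    exact (hA m x).trans (Finset.single_le_sum (f := A) (fun i _ => hA0 i) (by simp; omega))
  | succ k ih =>
    intro m hm x
    have hsm : ContDiff ℝ (⊤ : ℕ∞) (fun x : ℝ => (x:ℂ)^k * χ x) :=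
      ((Complex.ofRealCLM.contDiff).pow k).mul hχ
    have hz : ∀ x : ℝ, B ≤ |x| → (x:ℂ)^(k+1) * χ x = 0 := fun x hx => by rw [hB x hx, mul_zero]
    by_cases h : |x| ≤ B
    swap
    · rw [iter_zero_aux _ B hz m x (not_le.mp h)]; simp; positivity
    have he : (fun x : ℝ => (x:ℂ)^(k+1) * χ x) = fun x : ℝ => (x:ℂ) * ((x:ℂ)^k * χ x) := by
      funext x; ring
    rw [he]
    have hnn : 0 ≤ S * (B+4)^k := by positivity
    rcases m with _ | m
    · simp only [iteratedDeriv_zero, norm_mul (x:ℂ)]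
      have := ih 0 (by norm_num) x
      rw [iteratedDeriv_zero] at this
      calc _ ≤ B * (S * (B+4)^k) := by
            gcongr
            simpa using h
        _ ≤ _ := by rw [pow_succ]; nlinarith
    · rw [iter_mul_aux _ hsm]
      have h1 := ih (m+1) hm x
      have h2 := ih m (by omega) x
      have h3 : ‖((m:ℂ)+1)‖ ≤ 4 := by
        rw [show ((m:ℂ)+1) = ((m+1 : ℕ) : ℂ) by push_cast; rfl, Complex.norm_natCast]
        exact_mod_cast hm
      calc _ ≤ B * (S * (B+4)^k) + 4 * (S * (B+4)^k) := by
            refine (norm_add_le _ _).trans ?_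
            rw [norm_mul, norm_mul]
            gcongr
            simpa using h
        _ = _ := by ring

open FourierTransform in
lemma lemB (a b : ℝ) : ∃ (G : ℕ → ℝ → ℂ) (A C : ℝ), 0 ≤ A ∧ 0 ≤ C ∧ (∀ k, Continuous (G k)) ∧
    (∀ k η, (1+η^2)^2 * ‖G k η‖ ≤ A * C^k) ∧
    ∀ k, ∀ x ∈ Set.Icc a b, ∫ η : ℝ, Complex.exp (Complex.I * (x:ℂ) * (η:ℂ)) * G k η = (x:ℂ)^k := by
  rcases lt_or_ge b a with hab | hab
  · exact ⟨fun _ _ => 0, 0, 0, le_rfl, le_rfl, fun _ => continuous_const, by simp,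
      fun k x hx => absurd (hx.1.trans hx.2) (not_le.mpr hab)⟩
  let c : ContDiffBump ((a+b)/2) := ⟨(b-a)/2+1, (b-a)/2+2, by linarith, by linarith⟩
  let χ : ℝ → ℂ := fun x => ((c x : ℝ) : ℂ)
  let B : ℝ := |(a+b)/2| + ((b-a)/2+2)
  have hB0 : 0 ≤ B := by
    have := abs_nonneg ((a+b)/2)
    simp only [B]; linarith
  have hχ : ContDiff ℝ (⊤ : ℕ∞) χ := Complex.ofRealCLM.contDiff.comp c.contDiff
  have hχB : ∀ x, B ≤ |x| → χ x = 0 := by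
    intro x hx
    have : c x = 0 := by
      apply c.zero_of_le_dist
      rw [Real.dist_eq]
      have := abs_sub_abs_le_abs_sub x ((a+b)/2)
      simp only [B] at hx
      change (b-a)/2+2 ≤ _
      linarith
    simp [χ, this]
  have hχ1 : ∀ x ∈ Set.Icc a b, χ x = 1 := by
    intro x hx
    have : c x = 1 := by
      apply c.one_of_mem_closedBall
      rw [Metric.mem_closedBall, Real.dist_eq]
      change _ ≤ (b-a)/2+1
      rw [abs_le]; constructor <;> linarith [hx.1, hx.2]
    simp [χ, this]
  obtain ⟨A, hA0, hA⟩ := iter_bound_aux χ hχ B hB0 hχB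
  let f : ℕ → ℝ → ℂ := fun k x => (x:ℂ)^k * χ x
  have hsm : ∀ k, ContDiff ℝ (⊤ : ℕ∞) (f k) := fun k =>
      ((Complex.ofRealCLM.contDiff).pow k).mul hχ
  have hfz : ∀ k x, B ≤ |x| → f k x = 0 := fun k x hx => by simp [f, hχB x hx]
  have hc : ∀ k m, Continuous (iteratedDeriv m (f k)) := fun k m =>
    (hsm k).continuous_iteratedDeriv m (by exact_mod_cast le_top)
  have hcs : ∀ k m, HasCompactSupport (iteratedDeriv m (f k)) := fun k m =>
    HasCompactSupport.intro (isCompact_Icc (a := -B) (b := B)) fun x hx =>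
      iter_zero_aux _ B (hfz k) m x (by by_contra h; exact hx (abs_le.mp (not_lt.mp h)))
  have hint : ∀ k m, Integrable (iteratedDeriv m (f k)) := fun k m =>
    (hc k m).integrable_of_hasCompactSupport (hcs k m)
  have hnorm : ∀ k, ∀ m ≤ 4, ∫ x, ‖iteratedDeriv m (f k) x‖ ≤ 2*B*(A*(B+4)^k) := by
    intro k m hm
    have h1 : ∫ x, ‖iteratedDeriv m (f k) x‖ = ∫ x in Set.Icc (-B) B, ‖iteratedDeriv m (f k) x‖ := by
      rw [setIntegral_eq_integral_of_forall_compl_eq_zero]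
      intro x hx
      rw [iter_zero_aux _ B (hfz k) m x (by by_contra h; exact hx (abs_le.mp (not_lt.mp h)))]
      simp
    rw [h1]
    calc _ ≤ ∫ x in Set.Icc (-B) B, A*(B+4)^k := by
          apply integral_mono
          · exact (hint k m).norm.integrableOn
          · exact integrable_const _
          · intro x; exact hA k m hm x
      _ = _ := by
        simp [hB0]
        left; ring
  have hFb : ∀ k, ∀ v : ℝ, (1 + (2*Real.pi*v)^2)^2 * ‖𝓕 (f k) v‖ ≤ 8*B*A*(B+4)^k := by
    intro k v
    have e0 : ‖𝓕 (f k) v‖ ≤ 2*B*(A*(B+4)^k) := by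
      refine le_trans ?_ (hnorm k 0 (by norm_num))
      rw [iteratedDeriv_zero]
      exact VectorFourier.norm_fourierIntegral_le_integral_norm _ _ _ _ _
    have e4 : (2*Real.pi*v)^4 * ‖𝓕 (f k) v‖ ≤ 2*B*(A*(B+4)^k) := by
      refine le_trans ?_ (hnorm k 4 le_rfl)
      have := congrFun (Real.fourier_iteratedDeriv (N := ⊤) (n := 4) (hsm k) (fun n _ => hint k n) le_top) v
      have h2 : ‖𝓕 (iteratedDeriv 4 (f k)) v‖ ≤ ∫ x, ‖iteratedDeriv 4 (f k) x‖ :=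
        VectorFourier.norm_fourierIntegral_le_integral_norm _ _ _ _ _
      rw [this, norm_smul, norm_pow] at h2
      have h3 : ‖(2 * (Real.pi:ℂ) * Complex.I * (v:ℂ))‖ = |2*Real.pi*v| := by
        simp [abs_mul]
      rw [h3, Even.pow_abs (by decide)] at h2
      exact h2
    have : (1 + (2*Real.pi*v)^2)^2 ≤ 2 + 2*(2*Real.pi*v)^4 := by nlinarith [sq_nonneg ((2*Real.pi*v)^2 - 1)]
    calc _ ≤ (2 + 2*(2*Real.pi*v)^4) * ‖𝓕 (f k) v‖ := by gcongr
      _ = 2 * ‖𝓕 (f k) v‖ + 2 * ((2*Real.pi*v)^4 * ‖𝓕 (f k) v‖) := by ring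
      _ ≤ _ := by linarith
  have hf0 : ∀ k, Integrable (f k) := fun k => by simpa using hint k 0
  have hFc : ∀ k, Continuous (𝓕 (f k)) := fun k =>
    VectorFourier.fourierIntegral_continuous Real.continuous_fourierChar
      (by exact (innerSL ℝ).continuous₂) (hf0 k)
  have hFi : ∀ k, Integrable (𝓕 (f k)) := by
    intro k
    refine Integrable.mono' (integrable_inv_one_add_sq.const_mul (8*B*A*(B+4)^k)) (hFc k).aestronglyMeasurable ?_
    refine Filter.Eventually.of_forall fun v => ?_
    rw [← div_eq_mul_inv, le_div_iff₀ (by positivity), mul_comm]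
    refine le_trans ?_ (hFb k v)
    gcongr
    have hpi : 1 ≤ 2 * Real.pi := by linarith [Real.pi_gt_three]
    have : v^2 ≤ (2*Real.pi*v)^2 := by
      rw [mul_pow]; exact le_mul_of_one_le_left (sq_nonneg v) (one_le_pow₀ hpi)
    nlinarith [sq_nonneg v]
  refine ⟨fun k η => ((2*Real.pi : ℝ) : ℂ)⁻¹ * 𝓕 (f k) (η / (2*Real.pi)), 8*B*A, B+4, by positivity, by positivity,
    fun k => continuous_const.mul ((hFc k).comp (by fun_prop)), ?_, ?_⟩
  · intro k η
    have := hFb k (η / (2*Real.pi))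
    rw [mul_div_cancel₀ _ (by positivity)] at this
    refine le_trans ?_ this
    rw [norm_mul]
    gcongr
    refine mul_le_of_le_one_left (norm_nonneg _) ?_
    rw [norm_inv, Complex.norm_real, Real.norm_of_nonneg (by positivity)]
    exact inv_le_one_of_one_le₀ (by linarith [Real.pi_gt_three])
  · intro k x hx
    have hinv := congrFun ((hsm k).continuous.fourierInv_fourier_eq (hf0 k) (hFi k)) x
    have hs := Measure.integral_comp_div (fun v : ℝ => ((2*Real.pi : ℝ) : ℂ)⁻¹ * (Complex.exp (((2*Real.pi*v*x : ℝ):ℂ) * Complex.I) * 𝓕 (f k) v)) (2*Real.pi)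
    have hl : ∫ η : ℝ, Complex.exp (Complex.I * (x:ℂ) * (η:ℂ)) * (((2*Real.pi : ℝ) : ℂ)⁻¹ * 𝓕 (f k) (η / (2*Real.pi)))
       = ∫ η : ℝ, ((2*Real.pi : ℝ) : ℂ)⁻¹ * (Complex.exp (((2*Real.pi*(η/(2*Real.pi))*x : ℝ):ℂ) * Complex.I) * 𝓕 (f k) (η/(2*Real.pi))) := by
      congr 1; funext η
      rw [mul_div_cancel₀ _ (by positivity)]
      push_cast
      ring_nf
    rw [hl, hs, integral_const_mul, abs_of_pos (by positivity), Complex.real_smul, mul_inv_cancel_left₀ (by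
      exact_mod_cast (by positivity : (2*Real.pi) ≠ 0))]
    rw [Real.fourierInv_eq'] at hinv
    have hfk : f k x = (x:ℂ)^k := by simp [f, hχ1 x hx]
    rw [← hfk, ← hinv]
    congr 1; funext v
    rw [smul_eq_mul]
    simp
    left
    congr 1
    ring

lemma exp_cont_aux {μ : Measure ℝ} {u : ℝ → ℂ} (hu : Integrable u μ) :
    Continuous (fun x : ℝ => ∫ ξ, Complex.exp (Complex.I * (x:ℂ) * (ξ:ℂ)) * u ξ ∂μ) := by
  refine continuous_of_dominated (bound := fun ξ => ‖u ξ‖) (fun x => (int_exp_aux hu x).aestronglyMeasurable)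
    (fun x => Filter.Eventually.of_forall fun ξ => ?_) hu.norm
    (Filter.Eventually.of_forall fun ξ => by fun_prop)
  rw [norm_mul, norm_exp_aux, one_mul]

lemma exp_norm_aux {μ : Measure ℝ} (u : ℝ → ℂ) (x : ℝ) :
    ‖∫ ξ, Complex.exp (Complex.I * (x:ℂ) * (ξ:ℂ)) * u ξ ∂μ‖ ≤ ∫ ξ, ‖u ξ‖ ∂μ := by
  refine (norm_integral_le_integral_norm _).trans (le_of_eq ?_)
  simp_rw [norm_mul, norm_exp_aux, one_mul]

lemma lemC (ρ : Measure ℝ) (u : ℝ → ℂ) (hu : Integrable u ρ) (R : ℝ) (hR : 0 ≤ R)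
    (huR : ∀ ξ, R < |ξ| → u ξ = 0) (a b ε : ℝ) (hε : 0 < ε) :
    ∃ g : ℝ → ℂ, Continuous g ∧ (∀ η, (1+η^2)^2 * ‖g η‖ ≤ ε) ∧
      ∃ p : Polynomial ℂ, ∀ x ∈ Set.Icc a b,
        (∫ ξ, Complex.exp (Complex.I * (x:ℂ) * (ξ:ℂ)) * u ξ ∂ρ) +
          (∫ ξ : ℝ, Complex.exp (Complex.I * (x:ℂ) * (ξ:ℂ)) * g ξ) = p.eval (x:ℂ) := by
  obtain ⟨G, A, C, hA, hC, hGc, hGb, hG⟩ := lemB a b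
  let t : ℕ → ℝ → ℂ := fun k ξ => (Complex.I * (ξ:ℂ))^k / (k.factorial : ℂ) * u ξ
  let c : ℕ → ℂ := fun k => ∫ ξ, t k ξ ∂ρ
  have ht : ∀ k ξ, ‖t k ξ‖ ≤ R^k / (k.factorial : ℝ) * ‖u ξ‖ := by
    intro k ξ
    by_cases h : R < |ξ|
    · simp [t, huR ξ h]
    · simp only [t, norm_mul, norm_div, norm_pow, Complex.norm_I, one_mul, Complex.norm_real,
        Complex.norm_natCast, Real.norm_eq_abs]
      gcongr
      exact not_lt.mp h
  have htm : ∀ k, AEStronglyMeasurable (t k) ρ := fun k =>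
    (Continuous.aestronglyMeasurable (by fun_prop)).mul hu.aestronglyMeasurable
  let M := ∫ ξ, ‖u ξ‖ ∂ρ
  have hM : 0 ≤ M := integral_nonneg fun _ => norm_nonneg _
  have hc : ∀ k, ‖c k‖ ≤ R^k / (k.factorial : ℝ) * M := by
    intro k
    refine (norm_integral_le_of_norm_le (hu.norm.const_mul _) (Filter.Eventually.of_forall (ht k))).trans ?_
    rw [integral_const_mul]
  have hsum : ∀ x : ℝ, HasSum (fun k => c k * (x:ℂ)^k)
      (∫ ξ, Complex.exp (Complex.I * (x:ℂ) * (ξ:ℂ)) * u ξ ∂ρ) := by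
    intro x
    have hs := Real.summable_pow_div_factorial (R * |x|)
    have := hasSum_integral_of_dominated_convergence (μ := ρ) (F := fun k ξ => t k ξ * (x:ℂ)^k)
      (f := fun ξ => Complex.exp (Complex.I * (x:ℂ) * (ξ:ℂ)) * u ξ)
      (fun k ξ => (R*|x|)^k / (k.factorial:ℝ) * ‖u ξ‖)
      (fun k => (htm k).mul_const _)
      (fun k => Filter.Eventually.of_forall fun ξ => by
        rw [norm_mul, norm_pow, Complex.norm_real, Real.norm_eq_abs]
        calc _ ≤ R^k / (k.factorial : ℝ) * ‖u ξ‖ * |x|^k := by gcongr; exact ht k ξ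
          _ = _ := by rw [mul_pow]; ring)
      (Filter.Eventually.of_forall fun ξ => hs.mul_right _)
      (by simp_rw [tsum_mul_right]; exact hu.norm.const_mul _)
      (Filter.Eventually.of_forall fun ξ => by
        have he := (NormedSpace.expSeries_div_hasSum_exp (Complex.I * (x:ℂ) * (ξ:ℂ))).mul_right (u ξ)
        rw [← Complex.exp_eq_exp_ℂ] at he
        have hfe : (fun k => t k ξ * (x:ℂ)^k) =
            fun k => (Complex.I * (x:ℂ) * (ξ:ℂ))^k / (k.factorial : ℂ) * u ξ := by
          funext k
          simp only [t]
          ring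
        rw [hfe]
        exact he)
    simp_rw [integral_mul_const] at this
    exact this
  let d : ℕ → ℝ := fun k => ‖c k‖ * (A * C^k)
  have hd0 : ∀ k, 0 ≤ d k := fun k => by positivity
  have hd : Summable d := by
    refine Summable.of_nonneg_of_le hd0 (fun k => ?_) ((Real.summable_pow_div_factorial (R * C)).mul_left (M * A))
    calc d k ≤ R^k / (k.factorial : ℝ) * M * (A * C^k) := by
          simp only [d]; gcongr; exact hc k
      _ = _ := by rw [mul_pow]; ring
  obtain ⟨N, hN⟩ := ((tendsto_sum_nat_add d).eventually (gt_mem_nhds hε)).exists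
  have hdN : Summable fun k => d (k+N) := (summable_nat_add_iff N).2 hd
  let F : ℕ → ℝ → ℂ := fun k η => c (k+N) * G (k+N) η
  have hFb : ∀ k η, ‖F k η‖ ≤ d (k+N) * ((1+η^2)^2)⁻¹ := by
    intro k η
    rw [← div_eq_mul_inv, le_div_iff₀ (by positivity)]
    simp only [F, d, norm_mul]
    rw [mul_assoc]
    refine mul_le_mul_of_nonneg_left ?_ (norm_nonneg _)
    rw [mul_comm]
    exact hGb _ η
  have hi1 : ∀ η : ℝ, ((1+η^2)^2)⁻¹ ≤ (1+η^2)⁻¹ := fun η => by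
    apply inv_anti₀ (by positivity)
    nlinarith [sq_nonneg η]
  have hi2 : ∀ η : ℝ, ((1+η^2)^2)⁻¹ ≤ 1 := fun η =>
    inv_le_one_of_one_le₀ (one_le_pow₀ (by nlinarith [sq_nonneg η]))
  have hFs : ∀ η, Summable fun k => F k η := fun η =>
    Summable.of_norm_bounded (hdN.mul_right _) (fun k => hFb k η)
  have hgc : Continuous fun η => ∑' k, F k η := by
    refine continuous_tsum (fun k => continuous_const.mul (hGc _)) hdN fun k η => (hFb k η).trans ?_
    exact mul_le_of_le_one_right (hd0 _) (hi2 η)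
  refine ⟨fun η => -∑' k, F k η, hgc.neg, ?_, ∑ k ∈ Finset.range N, Polynomial.C (c k) * Polynomial.X^k, ?_⟩
  · intro η
    have := tsum_of_norm_bounded (hdN.hasSum.mul_right (((1+η^2)^2)⁻¹)) (fun k => hFb k η)
    rw [norm_neg]
    rw [← div_eq_mul_inv, le_div_iff₀ (by positivity)] at this
    rw [mul_comm]
    exact this.trans hN.le
  · intro x hx
    have h2 := hasSum_integral_of_dominated_convergence (μ := volume)
      (F := fun k (η : ℝ) => Complex.exp (Complex.I * (x:ℂ) * (η:ℂ)) * F k η)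
      (f := fun η : ℝ => Complex.exp (Complex.I * (x:ℂ) * (η:ℂ)) * ∑' k, F k η)
      (fun k η => d (k+N) * (1+η^2)⁻¹)
      (fun k => Continuous.aestronglyMeasurable
        ((by fun_prop : Continuous fun η : ℝ => Complex.exp (Complex.I * (x:ℂ) * (η:ℂ))).mul
          (continuous_const.mul (hGc _))))
      (fun k => Filter.Eventually.of_forall fun η => by
        rw [norm_mul, norm_exp_aux, one_mul]
        exact (hFb k η).trans (mul_le_mul_of_nonneg_left (hi1 η) (hd0 _)))
      (Filter.Eventually.of_forall fun ξ => hdN.mul_right _)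
      (by simp_rw [tsum_mul_right]; exact integrable_inv_one_add_sq.const_mul _)
      (Filter.Eventually.of_forall fun η => (hFs η).hasSum.mul_left _)
    have h3 : ∀ k, ∫ η : ℝ, Complex.exp (Complex.I * (x:ℂ) * (η:ℂ)) * F k η = c (k+N) * (x:ℂ)^(k+N) := by
      intro k
      rw [← hG (k+N) x hx, ← integral_const_mul]
      congr 1; funext η
      simp only [F]; ring
    simp_rw [h3] at h2
    have h4 := (hsum x).summable.sum_add_tsum_nat_add N
    rw [(hsum x).tsum_eq, h2.tsum_eq] at h4
    simp_rw [mul_neg, integral_neg]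
    rw [← h4]
    simp [Polynomial.eval_finsetSum]

/- A complex measure `ν` with `∫ ξ² d|ν| < ∞` is encoded by its polar decomposition: a finite
positive measure `ρ = |ν|` together with a density `w` of norm one `ρ`-a.e.; its Fourier
transform is `x ↦ ∫ e^{ixξ} w ξ ∂ρ` and `I₂ = ∫ ξ² ∂ρ`. -/
theorem stmt14 (ρ : Measure ℝ) [IsFiniteMeasure ρ] (w : ℝ → ℂ)
    (hwm : AEStronglyMeasurable w ρ) (hw : ∀ᵐ ξ ∂ρ, ‖w ξ‖ = 1)
    (hmom : Integrable (fun ξ : ℝ => ξ ^ 2) ρ)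
    (h : ℝ → ℂ)
    (hh : ∀ x : ℝ, h x = ∫ ξ, Complex.exp (Complex.I * (x : ℂ) * (ξ : ℂ)) * w ξ ∂ρ)
    (a b : ℝ) (hab : a ≤ b) :
    ∃ (ρn : ℕ → Measure ℝ) (wn : ℕ → ℝ → ℂ),
      (∀ n, IsFiniteMeasure (ρn n)) ∧
      (∀ n, AEStronglyMeasurable (wn n) (ρn n)) ∧
      (∀ n, ∀ᵐ ξ ∂(ρn n), ‖wn n ξ‖ = 1) ∧
      (∀ n, Integrable (fun ξ : ℝ => ξ ^ 2) (ρn n)) ∧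
      (∀ n, ∃ p : Polynomial ℂ, ∀ x ∈ Set.Icc a b,
        (∫ ξ, Complex.exp (Complex.I * (x : ℂ) * (ξ : ℂ)) * wn n ξ ∂(ρn n)) = p.eval (x : ℂ)) ∧
      Filter.Tendsto (fun n => ∫ ξ, ξ ^ 2 ∂(ρn n)) Filter.atTop
        (nhds (∫ ξ, ξ ^ 2 ∂ρ)) ∧
      (∀ μ : Measure ℝ, IsProbabilityMeasure μ → μ (Set.Icc a b)ᶜ = 0 →
        Filter.Tendsto
          (fun n => ∫ x, (∫ ξ, Complex.exp (Complex.I * (x : ℂ) * (ξ : ℂ)) * wn n ξ ∂(ρn n)) ∂μ)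
          Filter.atTop (nhds (∫ x, h x ∂μ))) := by
  classical
  let u : ℕ → ℝ → ℂ := fun n => (Set.Icc (-(n:ℝ)) n).indicator w
  have hwi : Integrable w ρ := Integrable.of_bound hwm 1 (hw.mono fun ξ h => h.le)
  have hui : ∀ n, Integrable (u n) ρ := fun n => hwi.indicator measurableSet_Icc
  have hub : ∀ n ξ, ‖u n ξ‖ ≤ ‖w ξ‖ := fun n ξ => norm_indicator_le_norm_self _ _
  have hub1 : ∀ n, ∀ᵐ ξ ∂ρ, ‖u n ξ‖ ≤ 1 := fun n => hw.mono fun ξ h => h ▸ hub n ξ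
  have huR : ∀ n : ℕ, ∀ ξ, (n:ℝ) < |ξ| → u n ξ = 0 := by
    intro n ξ h
    apply Set.indicator_of_notMem
    intro h2
    exact absurd (abs_le.mpr h2) (not_le.mpr h)
  have hulim : ∀ ξ, ∀ᶠ n : ℕ in Filter.atTop, u n ξ = w ξ := by
    intro ξ
    filter_upwards [Filter.eventually_ge_atTop ⌈|ξ|⌉₊] with n hn
    have hmem : ξ ∈ Set.Icc (-(n:ℝ)) n := abs_le.mp (Nat.ceil_le.mp hn)
    exact Set.indicator_of_mem hmem w
  have hu2b : ∀ n, ∀ᵐ ξ ∂ρ, ‖ξ^2 * ‖u n ξ‖‖ ≤ ξ^2 := fun n => (hub1 n).mono fun ξ h => by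
    rw [Real.norm_of_nonneg (by positivity)]
    exact mul_le_of_le_one_right (sq_nonneg _) h
  have hu2m : ∀ n, AEStronglyMeasurable (fun ξ : ℝ => ξ^2 * ‖u n ξ‖) ρ := fun n =>
    (Continuous.aestronglyMeasurable (by fun_prop)).mul (hui n).aestronglyMeasurable.norm
  have hu2 : ∀ n, Integrable (fun ξ : ℝ => ξ^2 * ‖u n ξ‖) ρ := fun n => hmom.mono' (hu2m n) (hu2b n)
  have hex := fun n : ℕ => lemC ρ (u n) (hui n) n (Nat.cast_nonneg n) (huR n) a b (1/((n:ℝ)+1)) (by positivity)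
  choose g hgc hgb p hp using hex
  have hb1 : ∀ n η, ‖g n η‖ ≤ (1/((n:ℝ)+1)) * (1+η^2)⁻¹ := by
    intro n η
    rw [← div_eq_mul_inv, le_div_iff₀ (by positivity), mul_comm]
    refine le_trans ?_ (hgb n η)
    gcongr
    nlinarith [sq_nonneg η]
  have hb2 : ∀ n η, η^2 * ‖g n η‖ ≤ (1/((n:ℝ)+1)) * (1+η^2)⁻¹ := by
    intro n η
    rw [← div_eq_mul_inv, le_div_iff₀ (by positivity)]
    refine le_trans ?_ (hgb n η)
    nlinarith [sq_nonneg η, norm_nonneg (g n η), mul_nonneg (sq_nonneg η) (norm_nonneg (g n η))]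
  have hBi : ∀ n : ℕ, Integrable (fun η : ℝ => (1/((n:ℝ)+1)) * (1+η^2)⁻¹) := fun n =>
    integrable_inv_one_add_sq.const_mul _
  have hgi : ∀ n, Integrable (g n) := fun n => (hBi n).mono' (hgc n).aestronglyMeasurable
    (Filter.Eventually.of_forall (hb1 n))
  have hgi2 : ∀ n, Integrable (fun η : ℝ => η^2 * ‖g n η‖) := fun n => (hBi n).mono'
    (Continuous.aestronglyMeasurable ((continuous_pow 2).mul (hgc n).norm))
    (Filter.Eventually.of_forall fun η => by
      rw [Real.norm_of_nonneg (by positivity)]; exact hb2 n η)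
  have hBint : ∀ n : ℕ, ∫ η : ℝ, (1/((n:ℝ)+1)) * (1+η^2)⁻¹ = (1/((n:ℝ)+1)) * Real.pi := fun n => by
    rw [integral_const_mul, integral_univ_inv_one_add_sq]
  have hI1 : ∀ n, ∫ η, ‖g n η‖ ≤ (1/((n:ℝ)+1)) * Real.pi := fun n =>
    (integral_mono (hgi n).norm (hBi n) (hb1 n)).trans (hBint n).le
  have hI2 : ∀ n, ∫ η, η^2 * ‖g n η‖ ≤ (1/((n:ℝ)+1)) * Real.pi := fun n =>
    (integral_mono (hgi2 n) (hBi n) (hb2 n)).trans (hBint n).le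
  have hlim0 : Filter.Tendsto (fun n : ℕ => (1/((n:ℝ)+1)) * Real.pi) Filter.atTop (nhds 0) := by
    simpa using tendsto_one_div_add_atTop_nhds_zero_nat.mul_const Real.pi
  have hcomb := fun n => combine ρ (u n) (g n) (hui n) (hu2 n) (hgi n) (hgi2 n)
  choose ρn wn h1 h2 h3 h4 h5 h6 using hcomb
  refine ⟨ρn, wn, h1, h2, h3, h4, fun n => ⟨p n, fun x hx => ?_⟩, ?_, ?_⟩
  · rw [h5]; exact hp n x hx
  · have hA : Filter.Tendsto (fun n => ∫ ξ, ξ^2 * ‖u n ξ‖ ∂ρ) Filter.atTop (nhds (∫ ξ, ξ^2 ∂ρ)) := by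
      refine tendsto_integral_of_dominated_convergence (fun ξ => ξ^2) hu2m hmom hu2b ?_
      filter_upwards [hw] with ξ hξ
      refine tendsto_const_nhds.congr' ?_
      filter_upwards [hulim ξ] with n hn
      rw [hn, hξ, mul_one]
    have hD : Filter.Tendsto (fun n => (∫ ξ, ξ^2 ∂(ρn n)) - ∫ ξ, ξ^2 * ‖u n ξ‖ ∂ρ) Filter.atTop (nhds 0) :=
      squeeze_zero_norm (fun n => (h6 n).trans (hI2 n)) hlim0
    simpa using hD.add hA
  · intro μ hμ _
    simp_rw [h5]
    refine tendsto_integral_of_dominated_convergence (fun _ => (∫ ξ, ‖w ξ‖ ∂ρ) + Real.pi)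
      (fun n => ((exp_cont_aux (hui n)).add (exp_cont_aux (hgi n))).aestronglyMeasurable)
      (integrable_const _) (fun n => Filter.Eventually.of_forall fun x => ?_)
      (Filter.Eventually.of_forall fun x => ?_)
    · refine (norm_add_le _ _).trans (add_le_add ?_ ?_)
      · exact (exp_norm_aux _ x).trans (integral_mono (hui n).norm hwi.norm (hub n))
      · refine ((exp_norm_aux _ x).trans (hI1 n)).trans (mul_le_of_le_one_left Real.pi_pos.le ?_)
        rw [div_le_one (by positivity)]
        linarith [Nat.cast_nonneg (α := ℝ) n]
    · rw [hh x, ← add_zero (∫ ξ, Complex.exp (Complex.I * (x : ℂ) * (ξ : ℂ)) * w ξ ∂ρ)]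
      refine Filter.Tendsto.add ?_ (squeeze_zero_norm (fun n => (exp_norm_aux _ x).trans (hI1 n)) hlim0)
      refine tendsto_integral_of_dominated_convergence (fun ξ => ‖w ξ‖)
        (fun n => (int_exp_aux (hui n) x).aestronglyMeasurable) hwi.norm
        (fun n => Filter.Eventually.of_forall fun ξ => ?_) (Filter.Eventually.of_forall fun ξ => ?_)
      · rw [norm_mul, norm_exp_aux, one_mul]; exact hub n ξ
      · refine tendsto_const_nhds.congr' ?_
        filter_upwards [hulim ξ] with n hn
        rw [hn]
end

section
/- Let ν be a compactly supported complex Borel measure on ℝ and set h = ν̂. Then there exists a sequence of smooth compactly supported functions ψ_n : ℝ → ℂ such that, setting h_n(x) = ∫_ℝ e^{ixξ} ψ_n(ξ) dξ: (1) ∫_ℝ ξ² |ψ_n(ξ)| dξ → ∫_ℝ ξ² |ν|(dξ) as n → ∞; and (2) for every finite positive Borel measure μ on ℝ, ∫ h_n dμ → ∫ h dμ as n → ∞. -/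
open MeasureTheory

namespace Stmt16Aux

open Filter Topology Set

/-- The bump functions used for mollification. -/
noncomputable def bump (n : ℕ) : ContDiffBump (0 : ℝ) where
  rIn := 1 / (2 * ((n : ℝ) + 1))
  rOut := 1 / ((n : ℝ) + 1)
  rIn_pos := by positivity
  rIn_lt_rOut := by
    apply one_div_lt_one_div_of_lt <;> nlinarith [Nat.cast_nonneg (α := ℝ) n]

/-- The normalized mollifier. -/
noncomputable def phi (n : ℕ) : ℝ → ℝ := (bump n).normed volume

lemma phi_nonneg (n : ℕ) (x : ℝ) : 0 ≤ phi n x := (bump n).nonneg_normed x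

lemma phi_cont (n : ℕ) : Continuous (phi n) := (bump n).continuous_normed

lemma phi_integral (n : ℕ) : ∫ x, phi n x = 1 := (bump n).integral_normed

lemma phi_integrable (n : ℕ) : Integrable (phi n) := (bump n).integrable_normed

lemma phi_zero (n : ℕ) (x : ℝ) (hx : 1 < |x|) : phi n x = 0 := by
  have h := (bump n).support_normed_eq (μ := volume)
  by_contra hne
  have hm : x ∈ Function.support ((bump n).normed volume) := hne
  rw [h, Metric.mem_ball, dist_zero_right, Real.norm_eq_abs] at hm
  have h2 : (bump n).rOut ≤ 1 := by
    change 1 / ((n : ℝ) + 1) ≤ 1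
    rw [div_le_one (by positivity)]
    linarith [Nat.cast_nonneg (α := ℝ) n]
  linarith

lemma phi_bdd (n : ℕ) : ∃ C : ℝ, ∀ x, ‖phi n x‖ ≤ C :=
  (bump n).hasCompactSupport_normed.exists_bound_of_continuous (phi_cont n)

lemma rOut_tendsto : Tendsto (fun n => (bump n).rOut) atTop (𝓝 0) :=
  tendsto_one_div_add_atTop_nhds_zero_nat

variable {𝕜 : Type} [RCLike 𝕜]

/-- The mollified density. -/
noncomputable def S (ρ : Measure ℝ) (f : ℝ → 𝕜) (n : ℕ) (ξ : ℝ) : 𝕜 :=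
  ∫ t, phi n (ξ - t) • f t ∂ρ

lemma S_contDiff (ρ : Measure ℝ) (f : ℝ → 𝕜) (hf : Integrable f ρ) (n : ℕ) :
    ContDiff ℝ (⊤ : ℕ∞) (S ρ f n) :=
  HasCompactSupport.contDiff_convolution_right (n := ⊤)
    (ContinuousLinearMap.lsmul ℝ ℝ : ℝ →L[ℝ] 𝕜 →L[ℝ] 𝕜).flip
    (bump n).hasCompactSupport_normed hf.locallyIntegrable (bump n).contDiff_normed

lemma S_zero (ρ : Measure ℝ) (f : ℝ → 𝕜) (a b : ℝ) (hf0 : ∀ t, t ∉ Icc a b → f t = 0) (n : ℕ)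
    (ξ : ℝ) (hξ : ξ ∉ Icc (a - 1) (b + 1)) (t : ℝ) : phi n (ξ - t) • f t = 0 := by
  by_cases ht : t ∈ Icc a b
  · rw [phi_zero, zero_smul]
    by_contra hle
    rw [not_lt, abs_le] at hle
    exact hξ ⟨by linarith [ht.1], by linarith [ht.2]⟩
  · rw [hf0 t ht, smul_zero]

lemma S_compact (ρ : Measure ℝ) (f : ℝ → 𝕜) (a b : ℝ) (hf0 : ∀ t, t ∉ Icc a b → f t = 0)
    (n : ℕ) : HasCompactSupport (S ρ f n) := by
  apply HasCompactSupport.intro (isCompact_Icc (a := a - 1) (b := b + 1))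
  intro ξ hξ
  unfold S
  simp only [S_zero ρ f a b hf0 n ξ hξ, integral_zero]

lemma FS_integrable (ρ : Measure ℝ) (f : ℝ → 𝕜) (hf : Integrable f ρ)
    (a b : ℝ) (hf0 : ∀ t, t ∉ Icc a b → f t = 0) (n : ℕ) (F : ℝ → 𝕜) (hF : Continuous F) :
    Integrable (fun ξ => F ξ * S ρ f n ξ) :=
  (hF.mul (S_contDiff ρ f hf n).continuous).integrable_of_hasCompactSupport
    (S_compact ρ f a b hf0 n).mul_left

lemma Ff_integrable (ρ : Measure ℝ) (f : ℝ → 𝕜) (hf : Integrable f ρ)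
    (a b : ℝ) (hf0 : ∀ t, t ∉ Icc a b → f t = 0) (F : ℝ → 𝕜) (hF : Continuous F) :
    Integrable (fun ξ => F ξ * f ξ) ρ := by
  obtain ⟨C, hC⟩ := (isCompact_Icc (a := a) (b := b)).exists_bound_of_continuousOn hF.continuousOn
  refine (hf.norm.const_mul C).mono' (hF.aestronglyMeasurable.mul hf.1) ?_
  refine Eventually.of_forall fun t => ?_
  by_cases ht : t ∈ Icc a b
  · rw [norm_mul]
    exact mul_le_mul_of_nonneg_right (hC t ht) (norm_nonneg _)
  · simp [hf0 t ht]

lemma key (ρ : Measure ℝ) [IsFiniteMeasure ρ] (f : ℝ → 𝕜) (hf : Integrable f ρ)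
    (a b : ℝ) (hf0 : ∀ t, t ∉ Icc a b → f t = 0) (F : ℝ → 𝕜) (hF : Continuous F) :
    Tendsto (fun n => ∫ ξ, F ξ * S ρ f n ξ) atTop (𝓝 (∫ t, F t * f t ∂ρ)) := by
  obtain ⟨C, hC⟩ := (isCompact_Icc (a := a - 1) (b := b + 1)).exists_bound_of_continuousOn
    hF.continuousOn
  have swap : ∀ n, ∫ ξ, F ξ * S ρ f n ξ = ∫ t, (∫ ξ, phi n (ξ - t) • F ξ) * f t ∂ρ := by
    intro n
    obtain ⟨D, hD⟩ := phi_bdd n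
    have hint : Integrable (Function.uncurry fun ξ t => F ξ * (phi n (ξ - t) • f t))
        ((volume : Measure ℝ).prod ρ) := by
      have h1 : Integrable (fun z : ℝ × ℝ =>
          ((Icc (a - 1) (b + 1)).indicator (fun _ => C * D) z.1) * ‖f z.2‖)
          ((volume : Measure ℝ).prod ρ) := by
        apply Integrable.mul_prod _ hf.norm
        exact (integrable_indicator_iff measurableSet_Icc).2
          (integrableOn_const measure_Icc_lt_top.ne)
      refine h1.mono' ?_ ?_
      · apply AEStronglyMeasurable.mul
        · exact (hF.comp continuous_fst).aestronglyMeasurable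
        · apply AEStronglyMeasurable.smul
          · exact ((phi_cont n).comp (continuous_fst.sub continuous_snd)).aestronglyMeasurable
          · exact hf.1.comp_snd
      · refine Eventually.of_forall fun z => ?_
        simp only [Function.uncurry]
        by_cases hz : z.1 ∈ Icc (a - 1) (b + 1)
        · rw [indicator_of_mem hz, norm_mul, norm_smul, ← mul_assoc]
          apply mul_le_mul_of_nonneg_right _ (norm_nonneg _)
          exact mul_le_mul (hC _ hz) (hD _) (norm_nonneg _) ((norm_nonneg _).trans (hC _ hz))
        · rw [S_zero ρ f a b hf0 n z.1 hz, indicator_of_notMem hz]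
          simp
    have : ∀ ξ, F ξ * S ρ f n ξ = ∫ t, F ξ * (phi n (ξ - t) • f t) ∂ρ := by
      intro ξ
      rw [integral_const_mul]; rfl
    simp only [this]
    rw [integral_integral_swap hint]
    congr 1
    ext t
    rw [← integral_mul_const]
    congr 1
    ext ξ
    simp only [RCLike.real_smul_eq_coe_mul]
    ring
  simp only [swap]
  have bdd : ∀ n t, t ∈ Icc a b → ‖∫ ξ, phi n (ξ - t) • F ξ‖ ≤ C := by
    intro n t ht
    have h1 : ∫ ξ, phi n (ξ - t) * C = C := by
      rw [integral_mul_const, integral_sub_right_eq_self (phi n) t, phi_integral, one_mul]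
    rw [← h1]
    apply norm_integral_le_of_norm_le (((phi_integrable n).comp_sub_right t).mul_const C)
    refine Eventually.of_forall fun ξ => ?_
    rw [norm_smul, Real.norm_of_nonneg (phi_nonneg _ _)]
    by_cases hξ : ξ ∈ Icc (a - 1) (b + 1)
    · exact mul_le_mul_of_nonneg_left (hC ξ hξ) (phi_nonneg _ _)
    · rw [phi_zero]
      · simp
      · by_contra hle
        rw [not_lt, abs_le] at hle
        exact hξ ⟨by linarith [ht.1], by linarith [ht.2]⟩
  apply tendsto_integral_of_dominated_convergence (fun t => C * ‖f t‖)
  · intro n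
    apply AEStronglyMeasurable.mul _ hf.1
    have hc : Continuous (Function.uncurry fun t ξ => phi n (ξ - t) • F ξ) :=
      ((phi_cont n).comp (continuous_snd.sub continuous_fst)).smul (hF.comp continuous_snd)
    exact (hc.stronglyMeasurable.integral_prod_right).aestronglyMeasurable
  · exact hf.norm.const_mul C
  · intro n
    refine Eventually.of_forall fun t => ?_
    by_cases ht : t ∈ Icc a b
    · rw [norm_mul]
      exact mul_le_mul_of_nonneg_right (bdd n t ht) (norm_nonneg _)
    · simp [hf0 t ht]
  · refine Eventually.of_forall fun t => ?_
    apply Tendsto.mul_const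
    have h := ContDiffBump.convolution_tendsto_right_of_continuous (μ := (volume : Measure ℝ))
      rOut_tendsto hF t
    refine h.congr fun n => ?_
    rw [convolution_def]
    rw [← integral_sub_left_eq_self (fun ξ => phi n (ξ - t) • F ξ) volume t]
    congr 1
    ext s
    have : t - s - t = -s := by ring
    rw [this]
    change _ = (bump n).normed volume (-s) • _
    rw [ContDiffBump.normed_neg]
    rfl

end Stmt16Aux

open Stmt16Aux in
theorem stmt16 (ρ : Measure ℝ) [IsFiniteMeasure ρ] (w : ℝ → ℂ)
    (hwm : AEStronglyMeasurable w ρ) (hw : ∀ᵐ ξ ∂ρ, ‖w ξ‖ = 1)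
    (a b : ℝ) (hsupp : ρ (Set.Icc a b)ᶜ = 0)
    (h : ℝ → ℂ)
    (hh : ∀ x : ℝ, h x = ∫ ξ, Complex.exp (Complex.I * (x : ℂ) * (ξ : ℂ)) * w ξ ∂ρ) :
    ∃ ψ : ℕ → ℝ → ℂ,
      (∀ n, ContDiff ℝ (⊤ : ℕ∞) (ψ n)) ∧ (∀ n, HasCompactSupport (ψ n)) ∧
      Filter.Tendsto (fun n => ∫ ξ : ℝ, ξ ^ 2 * ‖ψ n ξ‖) Filter.atTop
        (nhds (∫ ξ, ξ ^ 2 ∂ρ)) ∧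
      (∀ μ : Measure ℝ, IsFiniteMeasure μ →
        Filter.Tendsto
          (fun n => ∫ x, (∫ ξ : ℝ, Complex.exp (Complex.I * (x : ℂ) * (ξ : ℂ)) * ψ n ξ) ∂μ)
          Filter.atTop (nhds (∫ x, h x ∂μ))) := by
  have hmem : ∀ᵐ t ∂ρ, t ∈ Set.Icc a b := hsupp
  set f : ℝ → ℂ := (Set.Icc a b).indicator w with hfdef
  set o : ℝ → ℝ := (Set.Icc a b).indicator (fun _ => 1) with hodef
  have hf0 : ∀ t, t ∉ Set.Icc a b → f t = 0 := fun t ht => Set.indicator_of_notMem ht _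
  have ho0 : ∀ t, t ∉ Set.Icc a b → o t = 0 := fun t ht => Set.indicator_of_notMem ht _
  have hfw : ∀ᵐ t ∂ρ, f t = w t := hmem.mono fun t ht => Set.indicator_of_mem ht _
  have ho1 : ∀ᵐ t ∂ρ, o t = 1 := hmem.mono fun t ht => Set.indicator_of_mem ht _
  have hf1 : ∀ᵐ t ∂ρ, ‖f t‖ = 1 := by
    filter_upwards [hfw, hw] with t h1 h2
    rw [h1, h2]
  have hwi : Integrable w ρ :=
    Integrable.of_bound hwm 1 (hw.mono fun t ht => ht.le)
  have hf : Integrable f ρ := hwi.indicator measurableSet_Icc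
  have ho : Integrable o ρ := (integrable_const (1 : ℝ)).indicator measurableSet_Icc
  have hSle : ∀ n ξ, ‖S ρ f n ξ‖ ≤ S ρ o n ξ := by
    intro n ξ
    obtain ⟨D, hD⟩ := phi_bdd n
    apply norm_integral_le_of_norm_le
    · refine Integrable.bdd_mul ho (c := D) ?_ ?_
      · exact ((phi_cont n).comp (continuous_const.sub continuous_id)).aestronglyMeasurable
      · exact Filter.Eventually.of_forall fun t => hD _
    · filter_upwards [hf1, ho1] with t h1 h2
      rw [norm_smul, h1, h2, Real.norm_of_nonneg (phi_nonneg _ _)]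
      simp
  have hSc : ∀ n, Continuous (S ρ f n) := fun n => (S_contDiff ρ f hf n).continuous
  have hBi : ∀ n, Integrable (fun ξ : ℝ => ξ ^ 2 * ‖S ρ f n ξ‖) := fun n =>
    ((continuous_pow 2).mul (hSc n).norm).integrable_of_hasCompactSupport
      ((S_compact ρ f a b hf0 n).norm.mul_left)
  refine ⟨S ρ f, S_contDiff ρ f hf, S_compact ρ f a b hf0, ?_, ?_⟩
  · rw [tendsto_order]
    constructor
    · intro c hc
      set C : ℝ := a ^ 2 + b ^ 2 + 1 with hCdef
      have hCpos : 0 < C := by positivity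
      have hfc : Integrable (fun t => (starRingEnd ℂ) (f t)) ρ :=
        (Complex.conjLIE.toContinuousLinearEquiv : ℂ →L[ℝ] ℂ).integrable_comp hf
      obtain ⟨g, hg, hgi⟩ := hfc.exists_boundedContinuous_integral_sub_le
        (ε := ((∫ ξ, ξ ^ 2 ∂ρ) - c) / (4 * C)) (div_pos (by linarith) (by positivity))
      have hF1 : Continuous (fun ξ : ℝ => ((ξ ^ 2 : ℝ) : ℂ) * g ξ) := by fun_prop
      have hF2 : Continuous (fun ξ : ℝ => ξ ^ 2 * max (‖g ξ‖ - 1) 0) := by fun_prop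
      have k1 := key ρ f hf a b hf0 _ hF1
      have k2 := key ρ o ho a b ho0 _ hF2
      have k3 := ((Complex.continuous_re.tendsto _).comp k1).sub k2
      have i1 := Ff_integrable ρ f hf a b hf0 _ hF1
      have i2 := Ff_integrable ρ o ho a b ho0 _ hF2
      have hlim : c < (∫ t, ((t ^ 2 : ℝ) : ℂ) * g t * f t ∂ρ).re
          - ∫ t, t ^ 2 * max (‖g t‖ - 1) 0 * o t ∂ρ := by
        have e1 : (∫ t, ((t ^ 2 : ℝ) : ℂ) * g t * f t ∂ρ).re
            = ∫ t, (((t ^ 2 : ℝ) : ℂ) * g t * f t).re ∂ρ :=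
          (Complex.reCLM.integral_comp_comm i1).symm
        have hd : Integrable (fun t => ‖(starRingEnd ℂ) (f t) - g t‖) ρ := (hfc.sub hgi).norm
        have hsq : Integrable (fun t : ℝ => t ^ 2) ρ := by
          refine (Ff_integrable ρ o ho a b ho0 _ (continuous_pow 2)).congr ?_
          filter_upwards [ho1] with t ht
          rw [ht, mul_one]
        have i1' : Integrable (fun t => (((t ^ 2 : ℝ) : ℂ) * g t * f t).re) ρ := i1.re
        rw [e1, ← integral_sub i1' i2]
        have hle : ∫ t, (t ^ 2 - 2 * C * ‖(starRingEnd ℂ) (f t) - g t‖) ∂ρ ≤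
            ∫ t, ((((t ^ 2 : ℝ) : ℂ) * g t * f t).re - t ^ 2 * max (‖g t‖ - 1) 0 * o t) ∂ρ := by
          apply integral_mono_ae (hsq.sub (hd.const_mul _)) (i1'.sub i2)
          filter_upwards [hmem, hf1, ho1] with t ht h1 h2
          simp only [Pi.sub_apply]
          rw [h2, mul_one, mul_assoc (_ : ℂ), Complex.re_ofReal_mul]
          set d := ‖(starRingEnd ℂ) (f t) - g t‖ with hddef
          have hd0 : 0 ≤ d := norm_nonneg _
          have r1 : 1 - d ≤ (g t * f t).re := by
            have : (((starRingEnd ℂ) (f t) - g t) * f t).re ≤ d := by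
              refine (Complex.re_le_norm _).trans ?_
              rw [norm_mul, h1, mul_one]
            rw [sub_mul, Complex.sub_re, Complex.conj_mul', h1] at this
            norm_num at this
            rw [Complex.mul_re]; linarith [this]
          have r2 : max (‖g t‖ - 1) 0 ≤ d := by
            apply max_le _ hd0
            have : ‖g t‖ - ‖(starRingEnd ℂ) (f t)‖ ≤ ‖g t - (starRingEnd ℂ) (f t)‖ :=
              norm_sub_norm_le _ _
            rw [norm_sub_rev, RCLike.norm_conj, h1] at this
            exact this
          have r3 : t ^ 2 ≤ C := by
            rcases le_total 0 t with h0 | h0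
            · nlinarith [ht.1, ht.2, sq_nonneg a]
            · nlinarith [ht.1, ht.2, sq_nonneg b]
          have s1 := mul_le_mul_of_nonneg_left r1 (sq_nonneg t)
          have s2 := mul_le_mul_of_nonneg_left r2 (sq_nonneg t)
          have s3 := mul_le_mul_of_nonneg_right r3 hd0
          nlinarith
        refine lt_of_lt_of_le ?_ hle
        rw [integral_sub hsq (hd.const_mul _), integral_const_mul]
        have := mul_le_mul_of_nonneg_left hg (by positivity : 0 ≤ 2 * C)
        have e2 : 2 * C * (((∫ ξ, ξ ^ 2 ∂ρ) - c) / (4 * C)) = ((∫ ξ, ξ ^ 2 ∂ρ) - c) / 2 := by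
          field_simp
          ring
        rw [e2] at this
        linarith
      filter_upwards [k3.eventually (lt_mem_nhds hlim)] with n hn
      refine lt_of_lt_of_le hn ?_
      have j1 := FS_integrable ρ f hf a b hf0 n _ hF1
      have j2 := FS_integrable ρ o ho a b ho0 n _ hF2
      have j1' : Integrable (fun t => (((t ^ 2 : ℝ) : ℂ) * g t * S ρ f n t).re) := j1.re
      have e1 : (∫ t, ((t ^ 2 : ℝ) : ℂ) * g t * S ρ f n t).re
            = ∫ t, (((t ^ 2 : ℝ) : ℂ) * g t * S ρ f n t).re :=
          (Complex.reCLM.integral_comp_comm j1).symm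
      simp only [Function.comp]
      rw [e1, ← integral_sub j1' j2]
      apply integral_mono (j1'.sub j2) (hBi n)
      intro ξ
      simp only [Pi.sub_apply]
      rw [mul_assoc, Complex.re_ofReal_mul]
      have r1 : (g ξ * S ρ f n ξ).re ≤ ‖g ξ‖ * ‖S ρ f n ξ‖ := by
        rw [← norm_mul]; exact Complex.re_le_norm _
      have r2 := hSle n ξ
      have r3 : (‖g ξ‖ - 1) * ‖S ρ f n ξ‖ ≤ max (‖g ξ‖ - 1) 0 * S ρ o n ξ :=
        mul_le_mul (le_max_left _ _) r2 (norm_nonneg _) (le_max_right _ _)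
      have r4 : (g ξ * S ρ f n ξ).re - max (‖g ξ‖ - 1) 0 * S ρ o n ξ ≤ ‖S ρ f n ξ‖ := by
        linarith
      have := mul_le_mul_of_nonneg_left r4 (sq_nonneg ξ)
      linarith
    · intro c hc
      have k := key ρ o ho a b ho0 (fun ξ => ξ ^ 2) (continuous_pow 2)
      have e : ∫ t, t ^ 2 * o t ∂ρ = ∫ t, t ^ 2 ∂ρ := by
        apply integral_congr_ae
        filter_upwards [ho1] with t ht
        rw [ht, mul_one]
      rw [e] at k
      filter_upwards [k.eventually (gt_mem_nhds hc)] with n hn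
      refine lt_of_le_of_lt ?_ hn
      apply integral_mono (hBi n)
        (FS_integrable ρ o ho a b ho0 n (fun ξ => ξ ^ 2) (continuous_pow 2))
      intro ξ
      exact mul_le_mul_of_nonneg_left (hSle n ξ) (sq_nonneg ξ)
  · intro μ hμ
    have hnorm : ∀ x ξ : ℝ, ‖Complex.exp (Complex.I * (x : ℂ) * (ξ : ℂ))‖ = 1 := by
      intro x ξ
      rw [Complex.norm_exp]
      simp
    have k := key ρ o ho a b ho0 (fun _ => 1) continuous_const
    obtain ⟨M, hM⟩ := k.bddAbove_range
    apply tendsto_integral_of_dominated_convergence (fun _ => M)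
    · intro n
      have hc : Continuous (Function.uncurry fun x ξ : ℝ =>
          Complex.exp (Complex.I * (x : ℂ) * (ξ : ℂ)) * S ρ f n ξ) := by
        have := hSc n
        simp only [Function.uncurry_def]
        fun_prop
      exact (hc.stronglyMeasurable.integral_prod_right).aestronglyMeasurable
    · exact integrable_const _
    · intro n
      refine Filter.Eventually.of_forall fun x => ?_
      refine le_trans ?_ (hM ⟨n, rfl⟩)
      apply norm_integral_le_of_norm_le
        (FS_integrable ρ o ho a b ho0 n (fun _ => 1) continuous_const)
      refine Filter.Eventually.of_forall fun ξ => ?_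
      rw [norm_mul, hnorm, one_mul, one_mul]
      exact hSle n ξ
    · refine Filter.Eventually.of_forall fun x => ?_
      have k := key ρ f hf a b hf0
        (fun ξ : ℝ => Complex.exp (Complex.I * (x : ℂ) * (ξ : ℂ))) (by fun_prop)
      have e : h x = ∫ t : ℝ, Complex.exp (Complex.I * (x : ℂ) * (t : ℂ)) * f t ∂ρ := by
        rw [hh x]
        apply integral_congr_ae
        filter_upwards [hfw] with t ht
        rw [ht]
      rw [e]
      exact k
end
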